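/- Let g : ℝ → ℝ satisfy Assumption (G) and let ℓ > 0. Define C₅(x,ξ) = (ℓ⁵/720)(ξ⁵g⁽⁵⁾(x) + 5ξ³g⁽⁵⁾(x) + 15ξ³g⁽⁴⁾(x)g'(x) + 15ξg⁽⁴⁾(x)g'(x) + 30ξ³g⁽³⁾(x)g''(x) + 10ξg⁽³⁾(x)g''(x) + 30ξg⁽³⁾(x)g'(x)² + 35ξg'(x)g''(x)²), and for x ∈ ℝ^d let M̄_d(x) = d^{-1/2} Σ_{i=2}^d C₅(x_i, ξ_i) with ξ₂,…,ξ_d i.i.d. standard Gaussians, and φ_d(x,t) = E[exp(i t M̄_d(x))]. Let σ² = E[C₅(X,ξ₁)²], where X has density proportional to e^g and ξ₁ ~ N(0,1) is independent of X. Then there exists a sequence of Borel sets F_d ⊆ ℝ^d such that lim_{d→∞} d^{1/5} π_d(ℝ^d \ F_d) = 0 and, for every t ∈ ℝ, lim_{d→∞} sup_{x ∈ F_d} |φ_d(x,t) − e^{-σ² t²/2}| = 0. -/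

import Mathlib

open MeasureTheory ProbabilityTheory Filter
open scoped NNReal

/-- Assumption (G): `g ∈ C¹⁰(ℝ)`, `g''` bounded, the derivatives of `g` up to order 10 have
at most polynomial growth, and all moments of `e^g` are finite. -/
def AssumptionG (g : ℝ → ℝ) : Prop :=
  ContDiff ℝ 10 g ∧
  (∃ M : ℝ, ∀ t : ℝ, |iteratedDeriv 2 g t| ≤ M) ∧
  (∃ C : ℝ, ∃ κ : ℕ, ∀ i : ℕ, 1 ≤ i → i ≤ 10 → ∀ t : ℝ,
      |iteratedDeriv i g t| ≤ C * (1 + |t| ^ κ)) ∧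
  (∀ k : ℕ, Integrable (fun t : ℝ => t ^ k * Real.exp (g t)))

/-- The function `C₅(x,ξ)` appearing in the Taylor expansion of the fMALA log
acceptance ratio. -/
noncomputable def C5 (g : ℝ → ℝ) (ℓ : ℝ) (x ξ : ℝ) : ℝ :=
  let g1 := deriv g x
  let g2 := iteratedDeriv 2 g x
  let g3 := iteratedDeriv 3 g x
  let g4 := iteratedDeriv 4 g x
  let g5 := iteratedDeriv 5 g x
  (ℓ ^ 5 / 720) * (ξ ^ 5 * g5 + 5 * ξ ^ 3 * g5 + 15 * ξ ^ 3 * g4 * g1 + 15 * ξ * g4 * g1 +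
    30 * ξ ^ 3 * g3 * g2 + 10 * ξ * g3 * g2 + 30 * ξ * g3 * g1 ^ 2 + 35 * ξ * g1 * g2 ^ 2)

/-- `M̄_d(x) = d^{-1/2} Σ_{i=2}^d C₅(x_i, ξ_i)` (components indexed by `Fin d`, the sum
running over all indices except the first). -/
noncomputable def Mbar (g : ℝ → ℝ) (ℓ : ℝ) (d : ℕ) (x ξ : Fin d → ℝ) : ℝ :=
  (d : ℝ) ^ (-(1 : ℝ) / 2) * ∑ i ∈ Finset.univ.filter (fun i : Fin d => (i : ℕ) ≠ 0), C5 g ℓ (x i) (ξ i)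

/-- The characteristic function `φ_d(x,t)` of `M̄_d(x)`, the `ξ_i` being i.i.d. standard
Gaussian. -/
noncomputable def charFun' (g : ℝ → ℝ) (ℓ : ℝ) (d : ℕ) (x : Fin d → ℝ) (t : ℝ) : ℂ :=
  ∫ ξ : Fin d → ℝ, Complex.exp (Complex.I * t * Mbar g ℓ d x ξ)
    ∂(Measure.pi fun _ : Fin d => gaussianReal 0 1)

/-- The product target density `π_d` on `ℝ^d`. -/
noncomputable def prodTarget (g : ℝ → ℝ) (d : ℕ) (x : Fin d → ℝ) : ℝ :=
  (∏ i, Real.exp (g (x i))) / (∫ t : ℝ, Real.exp (g t)) ^ d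

/-- `σ² = E[C₅(X,ξ₁)²]`, `X` having density proportional to `e^g`, independent of
`ξ₁ ~ N(0,1)`. -/
noncomputable def sigmaSq (g : ℝ → ℝ) (ℓ : ℝ) : ℝ :=
  (∫ x : ℝ, (∫ ξ : ℝ, (C5 g ℓ x ξ) ^ 2 ∂(gaussianReal 0 1)) * Real.exp (g x)) /
    ∫ x : ℝ, Real.exp (g x)


lemma norm_cexp_I_mul_sub_taylor_two_le (y : ℝ) :
    ‖Complex.exp (Complex.I * y) - (1 + Complex.I * y - (y : ℂ) ^ 2 / 2)‖ ≤ 4 * |y| ^ 3 := by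
  have hn : ‖Complex.I * (y : ℂ)‖ = |y| := by simp
  rcases le_total |y| 1 with h | h
  · have := Complex.exp_bound (x := Complex.I * y) (by rw [hn]; exact h) (n := 3) (by norm_num)
    rw [hn] at this
    have e : ∑ m ∈ Finset.range 3, (Complex.I * (y : ℂ)) ^ m / (m.factorial : ℂ)
        = 1 + Complex.I * y - (y : ℂ) ^ 2 / 2 := by
      simp [Finset.sum_range_succ, mul_pow, Complex.I_sq]
      ring
    rw [e] at this
    refine this.trans ?_
    have h3 : 0 ≤ |y| ^ 3 := by positivity
    norm_num [Nat.factorial]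
    linarith
  · have h1 : ‖Complex.exp (Complex.I * y)‖ = 1 := Complex.norm_exp_I_mul_ofReal y
    have h2 : ‖(y : ℂ) ^ 2 / 2‖ = |y| ^ 2 / 2 := by simp
    have h3 : |y| ≤ |y| ^ 3 := by nlinarith [mul_nonneg (abs_nonneg y) (sub_nonneg.2 h)]
    have h4 : |y| ^ 2 ≤ |y| ^ 3 := by nlinarith [mul_nonneg (sq_nonneg |y|) (sub_nonneg.2 h)]
    calc _ ≤ ‖Complex.exp (Complex.I * y)‖ + (‖(1 : ℂ)‖ + ‖Complex.I * (y : ℂ)‖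
          + ‖(y : ℂ) ^ 2 / 2‖) :=
          (norm_sub_le _ _).trans (by
            gcongr; exact (norm_sub_le _ _).trans (by gcongr; exact norm_add_le _ _))
      _ ≤ _ := by
        rw [h1, h2, hn, norm_one]
        linarith

lemma abs_exp_neg_sub_one_sub_le_sq {u : ℝ} (hu : 0 ≤ u) :
    |Real.exp (-u) - (1 - u)| ≤ u ^ 2 := by
  have h0 := Real.add_one_le_exp (-u)
  rw [abs_of_nonneg (by linarith)]
  rcases le_total u 1 with h | h
  · have := Real.abs_exp_sub_one_sub_id_le (x := -u) (by rwa [abs_neg, abs_of_nonneg hu])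
    have := (abs_le.1 this).2
    nlinarith
  · have : Real.exp (-u) ≤ 1 := Real.exp_le_one_iff.2 (by linarith)
    nlinarith

lemma abs_exp_neg_sub_exp_neg_le {a b : ℝ} (ha : 0 ≤ a) (hb : 0 ≤ b) :
    |Real.exp (-a) - Real.exp (-b)| ≤ |a - b| := by
  wlog h : a ≤ b generalizing a b
  · rw [abs_sub_comm, abs_sub_comm a]
    exact this hb ha (le_of_not_ge h)
  have h1 : Real.exp (-b) ≤ Real.exp (-a) := Real.exp_le_exp.2 (by linarith)
  rw [abs_of_nonneg (by linarith), abs_sub_comm, abs_of_nonneg (by linarith)]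
  have h2 := Real.add_one_le_exp (-(b - a))
  have h3 : Real.exp (-b) = Real.exp (-a) * Real.exp (-(b - a)) := by
    rw [← Real.exp_add]; ring_nf
  have h4 : Real.exp (-a) ≤ 1 := Real.exp_le_one_iff.2 (by linarith)
  nlinarith [Real.exp_pos (-a)]

lemma norm_prod_sub_prod_le_sum {ι : Type*} (s : Finset ι) (a b : ι → ℂ)
    (ha : ∀ i ∈ s, ‖a i‖ ≤ 1) (hb : ∀ i ∈ s, ‖b i‖ ≤ 1) :
    ‖∏ i ∈ s, a i - ∏ i ∈ s, b i‖ ≤ ∑ i ∈ s, ‖a i - b i‖ := by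
  classical
  induction s using Finset.induction_on with
  | empty => simp
  | insert j s hj ih =>
    rw [Finset.prod_insert hj, Finset.prod_insert hj, Finset.sum_insert hj]
    have ih' := ih (fun i hi => ha i (Finset.mem_insert_of_mem hi))
      (fun i hi => hb i (Finset.mem_insert_of_mem hi))
    have hp : ‖∏ i ∈ s, a i‖ ≤ 1 := by
      rw [norm_prod]
      exact Finset.prod_le_one (fun _ _ => norm_nonneg _)
        (fun i hi => ha i (Finset.mem_insert_of_mem hi))
    have hbj := hb j (Finset.mem_insert_self _ _)
    calc _ = ‖(a j - b j) * ∏ i ∈ s, a i + b j * (∏ i ∈ s, a i - ∏ i ∈ s, b i)‖ := by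
          congr 1; ring
      _ ≤ ‖a j - b j‖ * 1 + 1 * ∑ i ∈ s, ‖a i - b i‖ := by
          refine (norm_add_le _ _).trans ?_
          rw [norm_mul, norm_mul]
          gcongr
      _ = _ := by ring

lemma norm_integral_cexp_sub_exp_variance_le {Ω : Type*} [MeasurableSpace Ω] (P : Measure Ω)
    [IsProbabilityMeasure P] {Y : Ω → ℝ} (hY : MemLp Y 3 P) (h0 : ∫ ω, Y ω ∂P = 0) (s : ℝ) :
    ‖∫ ω, Complex.exp (Complex.I * (s * Y ω : ℝ)) ∂P
        - (Real.exp (-(s ^ 2 * (∫ ω, Y ω ^ 2 ∂P) / 2)) : ℂ)‖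
      ≤ 4 * |s| ^ 3 * ∫ ω, |Y ω| ^ 3 ∂P + s ^ 4 * (∫ ω, Y ω ^ 2 ∂P) ^ 2 := by
  have hI1 : Integrable Y P := hY.integrable (by norm_num)
  have hI2 : Integrable (fun ω => Y ω ^ 2) P :=
    (hY.mono_exponent (p := 2) (by norm_num)).integrable_sq
  have hI3 : Integrable (fun ω => |Y ω| ^ 3) P := by
    have := hY.integrable_norm_pow (p := 3) (by norm_num)
    simpa using this
  have hm : AEStronglyMeasurable (fun ω => Complex.exp (Complex.I * (s * Y ω : ℝ))) P := by
    have := hY.1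
    refine Complex.continuous_exp.comp_aestronglyMeasurable ?_
    exact (Complex.continuous_ofReal.comp_aestronglyMeasurable (this.const_mul s)).const_mul _
  have hE : Integrable (fun ω => Complex.exp (Complex.I * (s * Y ω : ℝ))) P :=
    Integrable.of_bound hm 1 (Eventually.of_forall fun ω => (Complex.norm_exp_I_mul_ofReal _).le)
  have hI1' : Integrable (fun ω => (1 : ℂ) + Complex.I * (s * Y ω : ℝ)) P :=
    (integrable_const _).add (((hI1.const_mul s).ofReal).const_mul _)
  have hI2' : Integrable (fun ω => ((s ^ 2 * Y ω ^ 2 / 2 : ℝ) : ℂ)) P :=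
    ((hI2.const_mul (s ^ 2)).div_const 2).ofReal
  have hfun : (fun ω => (1 : ℂ) + Complex.I * (s * Y ω : ℝ) - ((s * Y ω : ℝ) : ℂ) ^ 2 / 2)
      = fun ω => ((1 : ℂ) + Complex.I * (s * Y ω : ℝ)) - ((s ^ 2 * Y ω ^ 2 / 2 : ℝ) : ℂ) := by
    funext ω; push_cast; ring
  have hR : Integrable
      (fun ω => (1 : ℂ) + Complex.I * (s * Y ω : ℝ) - ((s * Y ω : ℝ) : ℂ) ^ 2 / 2) P := by
    rw [hfun]
    exact hI1'.sub hI2'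
  have hRI : ∫ ω, ((1 : ℂ) + Complex.I * (s * Y ω : ℝ) - ((s * Y ω : ℝ) : ℂ) ^ 2 / 2) ∂P
      = ((1 - s ^ 2 * (∫ ω, Y ω ^ 2 ∂P) / 2 : ℝ) : ℂ) := by
    rw [hfun, integral_sub hI1' hI2',
      integral_add (integrable_const _) (((hI1.const_mul s).ofReal).const_mul _),
      integral_const_mul, integral_complex_ofReal, integral_complex_ofReal, integral_const_mul, integral_div,
      integral_const_mul, h0]
    simp
  have hT : ‖∫ ω, Complex.exp (Complex.I * (s * Y ω : ℝ)) ∂P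
      - ((1 - s ^ 2 * (∫ ω, Y ω ^ 2 ∂P) / 2 : ℝ) : ℂ)‖ ≤ 4 * |s| ^ 3 * ∫ ω, |Y ω| ^ 3 ∂P := by
    rw [← hRI, ← integral_sub hE hR, ← integral_const_mul]
    refine norm_integral_le_of_norm_le (hI3.const_mul _) (Eventually.of_forall fun ω => ?_)
    refine (norm_cexp_I_mul_sub_taylor_two_le _).trans (le_of_eq ?_)
    rw [abs_mul]; ring
  have hv : 0 ≤ ∫ ω, Y ω ^ 2 ∂P := integral_nonneg fun ω => sq_nonneg _
  have hG : ‖((1 - s ^ 2 * (∫ ω, Y ω ^ 2 ∂P) / 2 : ℝ) : ℂ)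
      - (Real.exp (-(s ^ 2 * (∫ ω, Y ω ^ 2 ∂P) / 2)) : ℂ)‖ ≤ s ^ 4 * (∫ ω, Y ω ^ 2 ∂P) ^ 2 := by
    rw [← Complex.ofReal_sub, Complex.norm_real, Real.norm_eq_abs, abs_sub_comm]
    refine (abs_exp_neg_sub_one_sub_le_sq (by positivity)).trans ?_
    nlinarith [show 0 ≤ s ^ 4 * (∫ ω, Y ω ^ 2 ∂P) ^ 2 by positivity]
  exact (norm_sub_le_norm_sub_add_norm_sub _ _ _).trans (add_le_add hT hG)

lemma pi_withDensity_ofReal {f : ℝ → ℝ} (hf0 : ∀ x, 0 ≤ f x) (hf : Integrable f) (d : ℕ) :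
    Measure.pi (fun _ : Fin d => (volume : Measure ℝ).withDensity fun x => ENNReal.ofReal (f x))
      = (volume : Measure (Fin d → ℝ)).withDensity
          fun x => ENNReal.ofReal (∏ i, f (x i)) := by
  have : IsFiniteMeasure ((volume : Measure ℝ).withDensity fun x => ENNReal.ofReal (f x)) :=
    isFiniteMeasure_withDensity_ofReal hf.2
  have hprod : Integrable (fun x : Fin d → ℝ => ∏ i, f (x i)) :=
    Integrable.fintype_prod (fun _ => hf)
  refine Measure.pi_eq fun s hs => ?_
  rw [withDensity_apply _ (MeasurableSet.univ_pi hs),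
    ← ofReal_integral_eq_lintegral_ofReal hprod.restrict
      (Eventually.of_forall fun x => Finset.prod_nonneg fun i _ => hf0 _),
    volume_pi, Measure.restrict_pi_pi, integral_fintype_prod_eq_prod (fun _ => f),
    ENNReal.ofReal_prod_of_nonneg fun i _ => integral_nonneg hf0]
  refine Finset.prod_congr rfl fun i _ => ?_
  rw [withDensity_apply _ (hs i), ← ofReal_integral_eq_lintegral_ofReal hf.restrict
    (Eventually.of_forall hf0)]

lemma setIntegral_prod_eq_pi_withDensity {f : ℝ → ℝ} (hf0 : ∀ x, 0 ≤ f x) (hf : Integrable f)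
    (d : ℕ) {s : Set (Fin d → ℝ)} (hs : MeasurableSet s) :
    ∫ x in s, ∏ i, f (x i) = (Measure.pi (fun _ : Fin d =>
      (volume : Measure ℝ).withDensity fun x => ENNReal.ofReal (f x))).real s := by
  have hprod : Integrable (fun x : Fin d → ℝ => ∏ i, f (x i)) :=
    Integrable.fintype_prod (fun _ => hf)
  rw [pi_withDensity_ofReal hf0 hf, measureReal_def, withDensity_apply _ hs,
    integral_eq_lintegral_of_nonneg_ae
      (Eventually.of_forall fun x => Finset.prod_nonneg fun i _ => hf0 _) hprod.1.restrict]

/-- Chebyshev's inequality for a sum, over a subset of the coordinates, of a function of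
i.i.d. variables. -/
lemma pi_real_abs_sum_sub_ge_le {μ : Measure ℝ} [IsProbabilityMeasure μ] {f : ℝ → ℝ}
    (hf : MemLp f 2 μ) (d : ℕ) (s : Finset (Fin d)) {c : ℝ} (hc : 0 < c) :
    (Measure.pi fun _ : Fin d => μ).real {x | c ≤ |∑ i ∈ s, (f (x i) - ∫ y, f y ∂μ)|}
      ≤ d * Var[f; μ] / c ^ 2 := by
  set X : Fin d → ℝ → ℝ := fun i => if i ∈ s then f else 0 with hX
  have hXm : ∀ i, MemLp (X i) 2 μ := fun i => by
    by_cases hi : i ∈ s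
    · simpa [hX, hi] using hf
    · simp only [hX, hi, if_false]
      exact MemLp.zero
  have hSm : ∀ i, MemLp (fun x : Fin d → ℝ => X i (x i)) 2 (Measure.pi fun _ : Fin d => μ) :=
    fun i => (hXm i).comp_measurePreserving (measurePreserving_eval (fun _ : Fin d => μ) i)
  have hmean : ∫ x, (∑ i, fun x : Fin d → ℝ => X i (x i)) x ∂(Measure.pi fun _ : Fin d => μ)
      = ∑ i ∈ s, ∫ y, f y ∂μ := by
    simp only [Finset.sum_apply]
    rw [integral_finsetSum _ fun i _ => (hSm i).integrable (by norm_num)]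
    rw [← Finset.sum_subset (Finset.subset_univ s)]
    · refine Finset.sum_congr rfl fun i hi => ?_
      rw [integral_comp_eval (hXm i).1]
      simp [hX, hi]
    · intro i _ hi
      simp [hX, hi]
  have hcheb := meas_ge_le_variance_div_sq (memLp_finsetSum' Finset.univ fun i _ => hSm i) hc
  rw [variance_sum_pi hXm, hmean] at hcheb
  have hset : {x : Fin d → ℝ | c ≤ |∑ i ∈ s, (f (x i) - ∫ y, f y ∂μ)|}
      = {x | c ≤ |(∑ i, fun x : Fin d → ℝ => X i (x i)) x - ∑ i ∈ s, ∫ y, f y ∂μ|} := by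
    ext x
    have : ∑ i ∈ s, (f (x i) - ∫ y, f y ∂μ)
        = (∑ i, fun x : Fin d → ℝ => X i (x i)) x - ∑ i ∈ s, ∫ y, f y ∂μ := by
      rw [Finset.sum_sub_distrib, Finset.sum_apply,
        ← Finset.sum_subset (Finset.subset_univ s) (fun i _ hi => by simp [hX, hi])]
      congr 1
      exact Finset.sum_congr rfl fun i hi => by simp [hX, hi]
    simp only [Set.mem_ofPred_eq, this]
  rw [hset]
  refine (ENNReal.toReal_le_of_le_ofReal (div_nonneg (Finset.sum_nonneg fun i _ =>
    variance_nonneg _ _) (sq_nonneg c)) hcheb).trans ?_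
  gcongr
  calc ∑ i, Var[X i; μ] ≤ ∑ _i : Fin d, Var[f; μ] := by
        refine Finset.sum_le_sum fun i _ => ?_
        by_cases hi : i ∈ s
        · simp [hX, hi]
        · simp [hX, hi, variance_nonneg]
    _ = _ := by simp

lemma integrable_one_add_sq_pow {ν : Measure ℝ} (h : ∀ k : ℕ, Integrable (fun x : ℝ => x ^ k) ν)
    (n : ℕ) : Integrable (fun x : ℝ => (1 + x ^ 2) ^ n) ν := by
  have key : ∀ n k : ℕ, Integrable (fun x : ℝ => x ^ k * (1 + x ^ 2) ^ n) ν := by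
    intro n
    induction n with
    | zero => simpa using h
    | succ n ih =>
      intro k
      refine ((ih k).add (ih (k + 2))).congr (Eventually.of_forall fun x => ?_)
      simp only [Pi.add_apply]
      ring
  simpa using key n 0

lemma memLp_of_abs_le_one_add_sq_pow {ν : Measure ℝ}
    (h : ∀ k : ℕ, Integrable (fun x : ℝ => x ^ k) ν) {f : ℝ → ℝ}
    (hf : AEStronglyMeasurable f ν) {A : ℝ} {n : ℕ}
    (hb : ∀ x, |f x| ≤ A * (1 + x ^ 2) ^ n) (p : ℕ) (hp : p ≠ 0) : MemLp f p ν := by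
  have hq : MemLp (fun x : ℝ => (1 + x ^ 2) ^ n) p ν := by
    rw [← integrable_norm_rpow_iff (by fun_prop) (by simpa using hp) (by simp)]
    refine (integrable_one_add_sq_pow h (n * p)).congr (Eventually.of_forall fun x => ?_)
    have : 0 ≤ (1 + x ^ 2) ^ n := by positivity
    simp only [ENNReal.toReal_natCast, Real.rpow_natCast, Real.norm_eq_abs, abs_of_nonneg this,
      pow_mul]
  refine hq.of_le_mul (c := A) hf (Eventually.of_forall fun x => ?_)
  rw [Real.norm_eq_abs, Real.norm_eq_abs, abs_of_nonneg (a := (1 + x ^ 2) ^ n) (by positivity)]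
  exact hb x

lemma integrable_pow_gaussianReal (k : ℕ) :
    Integrable (fun x : ℝ => x ^ k) (gaussianReal 0 1) := by
  rcases eq_or_ne k 0 with rfl | hk
  · simp
  · have h := (memLp_id_gaussianReal (μ := 0) (v := 1) k).integrable_norm_pow hk
    refine h.mono' (by fun_prop) (Eventually.of_forall fun x => ?_)
    simp

lemma C5_neg (g : ℝ → ℝ) (ℓ x ξ : ℝ) : C5 g ℓ x (-ξ) = -C5 g ℓ x ξ := by
  simp only [C5]; ring

lemma integral_C5 (g : ℝ → ℝ) (ℓ x : ℝ) : ∫ ξ, C5 g ℓ x ξ ∂(gaussianReal 0 1) = 0 := by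
  have hm : Continuous (C5 g ℓ x) := by unfold C5; fun_prop
  have h : ∫ ξ, C5 g ℓ x ξ ∂((gaussianReal 0 1).map fun y => -y)
      = -∫ ξ, C5 g ℓ x ξ ∂(gaussianReal 0 1) := by
    rw [integral_map (by fun_prop) hm.aestronglyMeasurable]
    simp only [C5_neg, integral_neg]
  rw [gaussianReal_map_neg, neg_zero] at h
  linarith

lemma continuous_uncurry_C5 {g : ℝ → ℝ} (hg : ContDiff ℝ 10 g) (ℓ : ℝ) :
    Continuous (fun p : ℝ × ℝ => C5 g ℓ p.1 p.2) := by
  have hi : ∀ i : ℕ, i ≤ 10 → Continuous (iteratedDeriv i g) := fun i hi =>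
    hg.continuous_iteratedDeriv i (by exact_mod_cast hi)
  have h1 : Continuous (deriv g) := by simpa [iteratedDeriv_one] using hi 1 (by norm_num)
  have h2 := hi 2 (by norm_num)
  have h3 := hi 3 (by norm_num)
  have h4 := hi 4 (by norm_num)
  have h5 := hi 5 (by norm_num)
  unfold C5
  fun_prop

lemma abs_C5_polynomial_le {B q ξ g1 g2 g3 g4 g5 : ℝ} (hB : 1 ≤ B)
    (h1 : |g1| ≤ B) (h2 : |g2| ≤ B) (h3 : |g3| ≤ B) (h4 : |g4| ≤ B) (h5 : |g5| ≤ B)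
    (q1 : |ξ| ≤ q) (q3 : |ξ| ^ 3 ≤ q) (q5 : |ξ| ^ 5 ≤ q) :
    |ξ ^ 5 * g5 + 5 * ξ ^ 3 * g5 + 15 * ξ ^ 3 * g4 * g1 + 15 * ξ * g4 * g1 +
      30 * ξ ^ 3 * g3 * g2 + 10 * ξ * g3 * g2 + 30 * ξ * g3 * g1 ^ 2 + 35 * ξ * g1 * g2 ^ 2|
      ≤ 141 * (q * B ^ 3) := by
  have hB0 : 0 ≤ B := by linarith
  have hq : 0 ≤ q := (abs_nonneg _).trans q1
  have hB13 : B ≤ B ^ 3 := le_self_pow₀ hB (by norm_num)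
  have hB23 : B ^ 2 ≤ B ^ 3 := pow_le_pow_right₀ hB (by norm_num)
  have e1 : |ξ ^ 5 * g5| ≤ q * B ^ 3 := by
    rw [abs_mul, abs_pow]
    exact mul_le_mul q5 (h5.trans hB13) (abs_nonneg _) hq
  have e2 : |5 * ξ ^ 3 * g5| ≤ 5 * (q * B ^ 3) := by
    rw [mul_assoc, abs_mul, abs_mul, abs_pow, abs_of_pos (show (0 : ℝ) < 5 by norm_num)]
    gcongr
    exact h5.trans hB13
  have quad {a b r c : ℝ} (hc : 0 ≤ c) (ha : |a| ≤ B) (hb : |b| ≤ B) (hr : |r| ≤ q) :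
      |c * r * a * b| ≤ c * (q * B ^ 3) := by
    rw [abs_mul, abs_mul, abs_mul, abs_of_nonneg hc]
    calc c * |r| * |a| * |b| ≤ c * q * B * B := by gcongr
      _ = c * (q * B ^ 2) := by ring
      _ ≤ _ := by gcongr
  have cub {a b r c : ℝ} (hc : 0 ≤ c) (ha : |a| ≤ B) (hb : |b| ≤ B) (hr : |r| ≤ q) :
      |c * r * a * b ^ 2| ≤ c * (q * B ^ 3) := by
    rw [abs_mul, abs_mul, abs_mul, abs_of_nonneg hc, abs_pow]
    calc c * |r| * |a| * |b| ^ 2 ≤ c * q * B * B ^ 2 := by gcongr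
      _ = _ := by ring
  have q3' : |ξ ^ 3| ≤ q := by rwa [abs_pow]
  have e3 := quad (c := 15) (by norm_num) h4 h1 q3'
  have e4 := quad (c := 15) (by norm_num) h4 h1 q1
  have e5 := quad (c := 30) (by norm_num) h3 h2 q3'
  have e6 := quad (c := 10) (by norm_num) h3 h2 q1
  have e7 := cub (c := 30) (by norm_num) h3 h1 q1
  have e8 := cub (c := 35) (by norm_num) h1 h2 q1
  rw [abs_le] at *
  constructor <;> linarith [e1.1, e1.2, e2.1, e2.2, e3.1, e3.2, e4.1, e4.2, e5.1, e5.2, e6.1,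
    e6.2, e7.1, e7.2, e8.1, e8.2]

lemma abs_pow_le_one_add_sq_pow (x : ℝ) {k n : ℕ} (h : k ≤ n) : |x| ^ k ≤ (1 + x ^ 2) ^ n := by
  have h1 : |x| ≤ 1 + x ^ 2 := by nlinarith [sq_abs x, sq_nonneg (|x| - 1)]
  calc |x| ^ k ≤ (1 + x ^ 2) ^ k := by gcongr
    _ ≤ _ := pow_le_pow_right₀ (by nlinarith [sq_nonneg x]) h

lemma exists_abs_C5_le {g : ℝ → ℝ} (hg : AssumptionG g) (ℓ : ℝ) :
    ∃ A : ℝ, 0 ≤ A ∧ ∃ m : ℕ, ∀ x ξ, |C5 g ℓ x ξ| ≤ A * (1 + x ^ 2) ^ m * (1 + ξ ^ 2) ^ 5 := by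
  obtain ⟨-, -, ⟨C, κ, hC⟩, -⟩ := hg
  refine ⟨|ℓ ^ 5 / 720| * 141 * (2 * |C| + 1) ^ 3, by positivity, κ * 3, fun x ξ => ?_⟩
  have hb1 : 1 ≤ (1 + x ^ 2) ^ κ := one_le_pow₀ (by nlinarith [sq_nonneg x])
  have hi : ∀ i : ℕ, 1 ≤ i → i ≤ 10 →
      |iteratedDeriv i g x| ≤ (2 * |C| + 1) * (1 + x ^ 2) ^ κ := fun i h1 h2 => by
    have hx := abs_pow_le_one_add_sq_pow x le_rfl (k := κ)
    calc _ ≤ C * (1 + |x| ^ κ) := hC i h1 h2 x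
      _ ≤ |C| * (2 * (1 + x ^ 2) ^ κ) := by
          gcongr
          · exact le_abs_self C
          · linarith
      _ ≤ _ := by nlinarith
  have h1 : |deriv g x| ≤ (2 * |C| + 1) * (1 + x ^ 2) ^ κ := by
    simpa [iteratedDeriv_one] using hi 1 (by norm_num) (by norm_num)
  have key := abs_C5_polynomial_le (ξ := ξ) (q := (1 + ξ ^ 2) ^ 5)
    (by nlinarith [abs_nonneg C]) h1 (hi 2 (by norm_num) (by norm_num))
    (hi 3 (by norm_num) (by norm_num)) (hi 4 (by norm_num) (by norm_num))
    (hi 5 (by norm_num) (by norm_num))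
    (by simpa using abs_pow_le_one_add_sq_pow ξ (k := 1) (n := 5) (by norm_num))
    (abs_pow_le_one_add_sq_pow ξ (by norm_num)) (abs_pow_le_one_add_sq_pow ξ (by norm_num))
  calc |C5 g ℓ x ξ| = |ℓ ^ 5 / 720| * _ := by simp only [C5]; rw [abs_mul]
    _ ≤ |ℓ ^ 5 / 720| * (141 * ((1 + ξ ^ 2) ^ 5 * ((2 * |C| + 1) * (1 + x ^ 2) ^ κ) ^ 3)) := by
        gcongr
    _ = _ := by rw [pow_mul]; ring

lemma memLp_C5 {g : ℝ → ℝ} (hg : AssumptionG g) (ℓ x : ℝ) (p : ℕ) (hp : p ≠ 0) :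
    MemLp (C5 g ℓ x) p (gaussianReal 0 1) := by
  obtain ⟨A, -, m, hA⟩ := exists_abs_C5_le hg ℓ
  have hm : Continuous (C5 g ℓ x) := by unfold C5; fun_prop
  exact memLp_of_abs_le_one_add_sq_pow integrable_pow_gaussianReal hm.aestronglyMeasurable
    (hA x) p hp

lemma exists_integral_abs_C5_pow_le {g : ℝ → ℝ} (hg : AssumptionG g) (ℓ : ℝ) (p : ℕ) :
    ∃ A : ℝ, 0 ≤ A ∧ ∃ m : ℕ, ∀ x,
      ∫ ξ, |C5 g ℓ x ξ| ^ p ∂(gaussianReal 0 1) ≤ A * (1 + x ^ 2) ^ m := by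
  obtain ⟨A, hA0, m, hA⟩ := exists_abs_C5_le hg ℓ
  refine ⟨A ^ p * ∫ ξ, (1 + ξ ^ 2) ^ (5 * p) ∂(gaussianReal 0 1),
    mul_nonneg (pow_nonneg hA0 p) (integral_nonneg fun ξ => by positivity), m * p, fun x => ?_⟩
  have hi := integrable_one_add_sq_pow integrable_pow_gaussianReal (5 * p)
  calc _ ≤ ∫ ξ, (A ^ p * (1 + x ^ 2) ^ (m * p)) * (1 + ξ ^ 2) ^ (5 * p) ∂(gaussianReal 0 1) := by
        refine integral_mono_of_nonneg (Eventually.of_forall fun ξ => by positivity)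
          (hi.const_mul _) (Eventually.of_forall fun ξ => ?_)
        refine (pow_le_pow_left₀ (abs_nonneg _) (hA x ξ) p).trans (le_of_eq ?_)
        simp only [mul_pow, pow_mul]
    _ = _ := by rw [integral_const_mul]; ring

lemma charFun'_eq_prod (g : ℝ → ℝ) (ℓ : ℝ) (d : ℕ) (x : Fin d → ℝ) (t : ℝ) :
    charFun' g ℓ d x t = ∏ i ∈ Finset.univ.filter (fun i : Fin d => (i : ℕ) ≠ 0),
      ∫ ξ, Complex.exp (Complex.I * (t * (d : ℝ) ^ (-(1 : ℝ) / 2) * C5 g ℓ (x i) ξ : ℝ))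
        ∂(gaussianReal 0 1) := by
  let h : Fin d → ℝ → ℂ := fun i ξ => if (i : ℕ) ≠ 0 then
    Complex.exp (Complex.I * (t * (d : ℝ) ^ (-(1 : ℝ) / 2) * C5 g ℓ (x i) ξ : ℝ)) else 1
  have h1 : ∀ ξ : Fin d → ℝ, Complex.exp (Complex.I * t * Mbar g ℓ d x ξ) = ∏ i, h i (ξ i) := by
    intro ξ
    simp only [h]
    rw [← Finset.prod_filter, ← Complex.exp_sum, ← Finset.mul_sum, ← Complex.ofReal_sum,
      ← Finset.mul_sum, Mbar, mul_assoc Complex.I, ← Complex.ofReal_mul, mul_assoc t]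
  simp only [charFun', h1]
  rw [integral_fintype_prod_eq_prod, Finset.prod_filter]
  refine Finset.prod_congr rfl fun i _ => ?_
  by_cases hi : (i : ℕ) = 0 <;> simp [h, hi]

lemma norm_charFun'_sub_exp_le {g : ℝ → ℝ} (hg : AssumptionG g) (ℓ : ℝ) (d : ℕ) (x : Fin d → ℝ)
    (t s : ℝ) (hs : s = t * (d : ℝ) ^ (-(1 : ℝ) / 2)) :
    ‖charFun' g ℓ d x t - (Real.exp (-(s ^ 2 *
        (∑ i ∈ Finset.univ.filter (fun i : Fin d => (i : ℕ) ≠ 0),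
          ∫ ξ, C5 g ℓ (x i) ξ ^ 2 ∂(gaussianReal 0 1)) / 2)) : ℂ)‖
      ≤ ∑ i ∈ Finset.univ.filter (fun i : Fin d => (i : ℕ) ≠ 0),
          (4 * |s| ^ 3 * ∫ ξ, |C5 g ℓ (x i) ξ| ^ 3 ∂(gaussianReal 0 1)
            + s ^ 4 * (∫ ξ, C5 g ℓ (x i) ξ ^ 2 ∂(gaussianReal 0 1)) ^ 2) := by
  rw [charFun'_eq_prod, ← hs, Finset.mul_sum, Finset.sum_div, ← Finset.sum_neg_distrib,
    Real.exp_sum, Complex.ofReal_prod]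
  refine (norm_prod_sub_prod_le_sum _ _ _ (fun i _ => ?_) fun i _ => ?_).trans
    (Finset.sum_le_sum fun i _ => ?_)
  · refine (norm_integral_le_integral_norm _).trans (le_of_eq ?_)
    simp only [Complex.norm_exp_I_mul_ofReal, integral_const, probReal_univ, smul_eq_mul, mul_one]
  · rw [Complex.norm_real, Real.norm_eq_abs, Real.abs_exp, Real.exp_le_one_iff, neg_nonpos]
    have : 0 ≤ ∫ ξ, C5 g ℓ (x i) ξ ^ 2 ∂(gaussianReal 0 1) := integral_nonneg fun _ => sq_nonneg _
    positivity
  · exact norm_integral_cexp_sub_exp_variance_le _ (memLp_C5 hg ℓ (x i) 3 (by norm_num))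
      (integral_C5 g ℓ (x i)) s

/-- The one-dimensional target, with density proportional to `e^g`. -/
noncomputable def targetMeasure (g : ℝ → ℝ) : Measure ℝ :=
  volume.withDensity fun x => ENNReal.ofReal (Real.exp (g x) / ∫ t : ℝ, Real.exp (g t))

lemma AssumptionG.integrable_exp {g : ℝ → ℝ} (hg : AssumptionG g) :
    Integrable fun t => Real.exp (g t) := by
  simpa using hg.2.2.2 0

lemma AssumptionG.integral_exp_pos {g : ℝ → ℝ} (hg : AssumptionG g) :
    0 < ∫ t, Real.exp (g t) :=
  MeasureTheory.integral_exp_pos hg.integrable_exp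

lemma AssumptionG.measurable_density {g : ℝ → ℝ} (hg : AssumptionG g) :
    Measurable fun x => ENNReal.ofReal (Real.exp (g x) / ∫ t : ℝ, Real.exp (g t)) := by
  have := hg.1.continuous.measurable
  fun_prop

lemma AssumptionG.isProbabilityMeasure {g : ℝ → ℝ} (hg : AssumptionG g) :
    IsProbabilityMeasure (targetMeasure g) := by
  refine ⟨?_⟩
  rw [targetMeasure, withDensity_apply _ MeasurableSet.univ, Measure.restrict_univ,
    ← ofReal_integral_eq_lintegral_ofReal (hg.integrable_exp.div_const _)
      (Eventually.of_forall fun x => div_nonneg (Real.exp_pos _).le hg.integral_exp_pos.le),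
    integral_div, div_self hg.integral_exp_pos.ne', ENNReal.ofReal_one]

lemma AssumptionG.integrable_pow {g : ℝ → ℝ} (hg : AssumptionG g) (k : ℕ) :
    Integrable (fun x : ℝ => x ^ k) (targetMeasure g) := by
  rw [targetMeasure, integrable_withDensity_iff_integrable_smul' hg.measurable_density
    (Eventually.of_forall fun _ => ENNReal.ofReal_lt_top)]
  refine ((hg.2.2.2 k).div_const (∫ t, Real.exp (g t))).congr (Eventually.of_forall fun x => ?_)
  simp only [ENNReal.toReal_ofReal (div_nonneg (Real.exp_pos (g x)).le hg.integral_exp_pos.le),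
    smul_eq_mul]
  ring

lemma AssumptionG.integral_targetMeasure {g : ℝ → ℝ} (hg : AssumptionG g) (f : ℝ → ℝ) :
    ∫ x, f x ∂(targetMeasure g) = (∫ x, f x * Real.exp (g x)) / ∫ x, Real.exp (g x) := by
  rw [targetMeasure, integral_withDensity_eq_integral_toReal_smul hg.measurable_density
    (Eventually.of_forall fun _ => ENNReal.ofReal_lt_top), ← integral_div]
  refine integral_congr_ae (Eventually.of_forall fun x => ?_)
  simp only [ENNReal.toReal_ofReal (div_nonneg (Real.exp_pos (g x)).le hg.integral_exp_pos.le),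
    smul_eq_mul]
  ring

lemma AssumptionG.setIntegral_prodTarget {g : ℝ → ℝ} (hg : AssumptionG g) (d : ℕ)
    {s : Set (Fin d → ℝ)} (hs : MeasurableSet s) :
    ∫ x in s, prodTarget g d x = (Measure.pi fun _ : Fin d => targetMeasure g).real s := by
  rw [targetMeasure, ← setIntegral_prod_eq_pi_withDensity
    (fun x => div_nonneg (Real.exp_pos _).le hg.integral_exp_pos.le)
    (hg.integrable_exp.div_const _) d hs]
  simp [prodTarget, Finset.prod_div_distrib]

lemma card_filter_val_ne_zero {d : ℕ} (hd : 1 ≤ d) :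
    ((Finset.univ.filter (fun i : Fin d => (i : ℕ) ≠ 0)).card : ℝ) = d - 1 := by
  obtain ⟨n, rfl⟩ : ∃ n, d = n + 1 := ⟨d - 1, by omega⟩
  have : Finset.univ.filter (fun i : Fin (n + 1) => (i : ℕ) ≠ 0) = Finset.univ.erase 0 := by
    ext i
    simp only [Finset.mem_filter, Finset.mem_erase, Finset.mem_univ, true_and, and_true, ne_eq,
      Fin.ext_iff, Fin.val_zero]
  rw [this, Finset.card_erase_of_mem (Finset.mem_univ _)]
  simp

theorem fmala_uniform_clt (g : ℝ → ℝ) (hg : AssumptionG g) (ℓ : ℝ) (hℓ : 0 < ℓ) :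
    ∃ F : (d : ℕ) → Set (Fin d → ℝ),
      (∀ d, MeasurableSet (F d)) ∧
      Tendsto (fun d : ℕ => (d : ℝ) ^ ((1 : ℝ) / 5) * ∫ x in (F d)ᶜ, prodTarget g d x)
        atTop (nhds 0) ∧
      ∀ t : ℝ, ∀ ε : ℝ, 0 < ε → ∃ N : ℕ, ∀ d : ℕ, N ≤ d → ∀ x ∈ F d,
        ‖charFun' g ℓ d x t - Complex.exp (-(sigmaSq g ℓ * t ^ 2) / 2)‖ ≤ ε := by
  have hprob := hg.isProbabilityMeasure
  obtain ⟨A₂, hA₂, m₂, hv₂⟩ := exists_integral_abs_C5_pow_le hg ℓ 2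
  obtain ⟨A₃, hA₃, m₃, hv₃⟩ := exists_integral_abs_C5_pow_le hg ℓ 3
  let S : (d : ℕ) → Finset (Fin d) := fun d => Finset.univ.filter (fun i : Fin d => (i : ℕ) ≠ 0)
  let v : ℝ → ℝ := fun x => ∫ ξ, C5 g ℓ x ξ ^ 2 ∂(gaussianReal 0 1)
  let w : ℝ → ℝ := fun x => (A₃ + A₂ ^ 2) * (1 + x ^ 2) ^ (m₃ + 2 * m₂)
  have hv0 : ∀ x, 0 ≤ v x := fun x => integral_nonneg fun _ => sq_nonneg _
  have hw0 : ∀ x, 0 ≤ w x := fun x => by positivity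
  have hvle : ∀ x, v x ≤ A₂ * (1 + x ^ 2) ^ m₂ := fun x => by simpa [v] using hv₂ x
  have hone : ∀ x : ℝ, 1 ≤ 1 + x ^ 2 := fun x => by nlinarith [sq_nonneg x]
  have hw3 : ∀ x, ∫ ξ, |C5 g ℓ x ξ| ^ 3 ∂(gaussianReal 0 1) ≤ w x := fun x => by
    refine (hv₃ x).trans ?_
    have := pow_le_pow_right₀ (hone x) (show m₃ ≤ m₃ + 2 * m₂ by omega)
    have h2 := sq_nonneg A₂
    simp only [w]
    gcongr
    linarith
  have hw2 : ∀ x, v x ^ 2 ≤ w x := fun x => by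
    refine (pow_le_pow_left₀ (hv0 x) (hvle x) 2).trans ?_
    rw [mul_pow, ← pow_mul]
    have := pow_le_pow_right₀ (hone x) (show m₂ * 2 ≤ m₃ + 2 * m₂ by omega)
    simp only [w]
    gcongr
    linarith
  have hvm : Measurable v := by
    have : StronglyMeasurable fun p : ℝ × ℝ => C5 g ℓ p.1 p.2 ^ 2 :=
      ((continuous_uncurry_C5 hg.1 ℓ).pow 2).stronglyMeasurable
    exact this.integral_prod_right'.measurable
  have hwm : Measurable w := by fun_prop
  have hvL : MemLp v 2 (targetMeasure g) := by
    exact_mod_cast memLp_of_abs_le_one_add_sq_pow hg.integrable_pow hvm.aestronglyMeasurable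
      (fun x => by rw [abs_of_nonneg (hv0 x)]; exact hvle x) 2 (by norm_num)
  have hwL : MemLp w 2 (targetMeasure g) := by
    exact_mod_cast memLp_of_abs_le_one_add_sq_pow hg.integrable_pow hwm.aestronglyMeasurable
      (fun x => (abs_of_nonneg (hw0 x)).le) 2 (by norm_num)
  have hσ : ∫ x, v x ∂(targetMeasure g) = sigmaSq g ℓ := hg.integral_targetMeasure v
  set σ := sigmaSq g ℓ
  have hσ0 : 0 ≤ σ := hσ ▸ integral_nonneg hv0
  set W := ∫ x, w x ∂(targetMeasure g)
  have hW0 : 0 ≤ W := integral_nonneg hw0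
  let E : (ℝ → ℝ) → (d : ℕ) → Set (Fin d → ℝ) := fun f d =>
    {x | (d : ℝ) ^ ((4 : ℝ) / 5) ≤ |∑ i ∈ S d, (f (x i) - ∫ y, f y ∂(targetMeasure g))|}
  have hEm : ∀ f, Measurable f → ∀ d, MeasurableSet (E f d) := fun f hf d =>
    measurableSet_le measurable_const (by fun_prop)
  have htend : ∀ y : ℝ, 0 < y → Tendsto (fun d : ℕ => (d : ℝ) ^ (-y)) atTop (nhds 0) :=
    fun y hy => (tendsto_rpow_neg_atTop hy).comp tendsto_natCast_atTop_atTop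
  refine ⟨fun d => (E v d ∪ E w d)ᶜ, fun d => ((hEm v hvm d).union (hEm w hwm d)).compl, ?_, ?_⟩
  · have hlim : Tendsto (fun d : ℕ => (Var[v; targetMeasure g] + Var[w; targetMeasure g])
        * (d : ℝ) ^ (-((2 : ℝ) / 5))) atTop (nhds 0) := by
      simpa using (htend (2 / 5) (by norm_num)).const_mul
        (Var[v; targetMeasure g] + Var[w; targetMeasure g])
    refine squeeze_zero' (Eventually.of_forall fun d => ?_) ?_ hlim
    · rw [compl_compl, hg.setIntegral_prodTarget d ((hEm v hvm d).union (hEm w hwm d))]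
      positivity
    · filter_upwards [eventually_ge_atTop 1] with d hd
      have hd0 : (0 : ℝ) < d := by exact_mod_cast hd
      rw [compl_compl, hg.setIntegral_prodTarget d ((hEm v hvm d).union (hEm w hwm d))]
      have hcheb := (measureReal_union_le (E v d) (E w d)).trans (add_le_add
        (pi_real_abs_sum_sub_ge_le hvL d (S d) (Real.rpow_pos_of_pos hd0 (4 / 5)))
        (pi_real_abs_sum_sub_ge_le hwL d (S d) (Real.rpow_pos_of_pos hd0 (4 / 5))))
      refine (mul_le_mul_of_nonneg_left hcheb (by positivity)).trans (le_of_eq ?_)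
      have hexp : (d : ℝ) ^ ((1 : ℝ) / 5) * d = (d : ℝ) ^ (-((2 : ℝ) / 5))
          * ((d : ℝ) ^ ((4 : ℝ) / 5)) ^ 2 := by
        rw [← Real.rpow_natCast, ← Real.rpow_mul hd0.le, ← Real.rpow_add hd0]
        nth_rewrite 2 [← Real.rpow_one (d : ℝ)]
        rw [← Real.rpow_add hd0]
        norm_num
      have hpos : ((d : ℝ) ^ ((4 : ℝ) / 5)) ^ 2 ≠ 0 := by positivity
      rw [← add_div, ← mul_div_assoc, div_eq_iff hpos]
      linear_combination (Var[v; targetMeasure g] + Var[w; targetMeasure g]) * hexp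
  · intro t ε hε
    have hlim : Tendsto (fun d : ℕ => (4 * |t| ^ 3 * (d : ℝ) ^ (-((1 : ℝ) / 2))
          + t ^ 4 * (d : ℝ) ^ (-(1 : ℝ))) * (1 + W)
        + t ^ 2 / 2 * ((d : ℝ) ^ (-((1 : ℝ) / 5)) + σ * (d : ℝ) ^ (-(1 : ℝ)))) atTop (nhds 0) := by
      have h1 := htend (1 / 2) (by norm_num)
      have h2 := htend 1 (by norm_num)
      have h3 := htend (1 / 5) (by norm_num)
      simpa using (((h1.const_mul (4 * |t| ^ 3)).add (h2.const_mul (t ^ 4))).mul_const (1 + W)).add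
        ((h3.add (h2.const_mul σ)).const_mul (t ^ 2 / 2))
    obtain ⟨N, hN⟩ := eventually_atTop.1 (hlim.eventually (ge_mem_nhds hε))
    refine ⟨max N 1, fun d hd x hx => le_trans ?_ (hN d (le_of_max_le_left hd))⟩
    have hd1 : 1 ≤ d := le_of_max_le_right hd
    have hd1' : (1 : ℝ) ≤ d := by exact_mod_cast hd1
    have hd0 : (0 : ℝ) < d := by linarith
    simp only [E, Set.mem_compl_iff, Set.mem_union, Set.mem_ofPred_eq, not_or, not_le] at hx
    obtain ⟨hxv, hxw⟩ := hx
    rw [hσ, Finset.sum_sub_distrib, Finset.sum_const, nsmul_eq_mul,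
      card_filter_val_ne_zero hd1] at hxv
    rw [Finset.sum_sub_distrib, Finset.sum_const, nsmul_eq_mul,
      card_filter_val_ne_zero hd1] at hxw
    set r := (d : ℝ) ^ (-((1 : ℝ) / 2)) with hr
    set b := (d : ℝ) ^ ((4 : ℝ) / 5) with hb
    have hr0 : 0 < r := Real.rpow_pos_of_pos hd0 _
    have hr2 : (d : ℝ) ^ (-(1 : ℝ)) = r ^ 2 := by
      rw [hr, ← Real.rpow_natCast, ← Real.rpow_mul hd0.le]; norm_num
    have hrd : r ^ 2 * d = 1 := by
      rw [← hr2, Real.rpow_neg_one, inv_mul_cancel₀ hd0.ne']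
    have hrb : (d : ℝ) ^ (-((1 : ℝ) / 5)) = r ^ 2 * b := by
      rw [← hr2, hb, ← Real.rpow_add hd0]; norm_num
    have hbd : b ≤ d := by
      simpa using Real.rpow_le_rpow_of_exponent_le hd1' (show (4 : ℝ) / 5 ≤ 1 by norm_num)
    rw [hr2, hrb]
    have hmain := norm_charFun'_sub_exp_le hg ℓ d x t (t * r) (by rw [hr, neg_div])
    have hsumw : ∑ i ∈ S d, w (x i) ≤ d * (1 + W) := by
      have := (abs_lt.1 hxw).2
      nlinarith
    have herr : ∑ i ∈ S d, (4 * |t * r| ^ 3 * ∫ ξ, |C5 g ℓ (x i) ξ| ^ 3 ∂(gaussianReal 0 1)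
            + (t * r) ^ 4 * (∫ ξ, C5 g ℓ (x i) ξ ^ 2 ∂(gaussianReal 0 1)) ^ 2)
        ≤ (4 * |t| ^ 3 * r + t ^ 4 * r ^ 2) * (1 + W) := by
      calc _ ≤ ∑ i ∈ S d, (4 * |t * r| ^ 3 * w (x i) + (t * r) ^ 4 * w (x i)) := by
            refine Finset.sum_le_sum fun i _ => ?_
            have h3 := hw3 (x i)
            have h2 := hw2 (x i)
            gcongr
        _ = (4 * |t * r| ^ 3 + (t * r) ^ 4) * ∑ i ∈ S d, w (x i) := by
            rw [Finset.mul_sum]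
            exact Finset.sum_congr rfl fun i _ => by ring
        _ ≤ (4 * |t * r| ^ 3 + (t * r) ^ 4) * (d * (1 + W)) := by gcongr
        _ = _ := by
            rw [abs_mul, abs_of_pos hr0]
            linear_combination (4 * |t| ^ 3 * r + t ^ 4 * r ^ 2) * (1 + W) * hrd
    have hgauss : ‖(Real.exp (-((t * r) ^ 2 * (∑ i ∈ S d, v (x i)) / 2)) : ℂ)
        - Complex.exp (-(σ * t ^ 2) / 2)‖ ≤ t ^ 2 / 2 * (r ^ 2 * b + σ * r ^ 2) := by
      have hcast : Complex.exp (-(σ * t ^ 2) / 2) = (Real.exp (-(σ * t ^ 2 / 2)) : ℂ) := by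
        push_cast; ring_nf
      have hS0 : 0 ≤ ∑ i ∈ S d, v (x i) := Finset.sum_nonneg fun i _ => hv0 _
      rw [hcast, ← Complex.ofReal_sub, Complex.norm_real, Real.norm_eq_abs]
      refine (abs_exp_neg_sub_exp_neg_le (by positivity) (by positivity)).trans ?_
      have hfac : (t * r) ^ 2 * (∑ i ∈ S d, v (x i)) / 2 - σ * t ^ 2 / 2
          = t ^ 2 / 2 * (r ^ 2 * (∑ i ∈ S d, v (x i) - (d - 1) * σ - σ)) := by
        linear_combination (t ^ 2 / 2 * σ) * hrd
      rw [hfac, abs_mul, abs_mul, abs_of_nonneg (a := t ^ 2 / 2) (by positivity),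
        abs_of_nonneg (sq_nonneg r), show r ^ 2 * b + σ * r ^ 2 = r ^ 2 * (b + σ) by ring]
      gcongr
      refine (abs_sub _ _).trans ?_
      rw [abs_of_nonneg hσ0]
      gcongr
    exact (norm_sub_le_norm_sub_add_norm_sub _ _ _).trans
      (add_le_add (hmain.trans herr) hgauss)
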